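/- Let (N, ∘_λ, ∗_λ) be a Novikov-Poisson conformal algebra. Define [a_λ b] = a∗_λ b − b∗_{−∂−λ} a for all a, b ∈ N. Then (N, ∘_λ, [·_λ·]) is a transposed Poisson conformal algebra. -/

import Mathlib

/-!
We model a `ℂ[∂]`-module as a complex vector space `L` together with an
endomorphism `D` (the action of `∂`).  A `λ`-product (or `λ`-bracket) is a
`ℂ`-bilinear map `L → L → L[λ]`, where the polynomial `x ∘_λ y = Σₙ λⁿ • cₙ`
is encoded by its finitely supported family of coefficients `ℕ →₀ L`.
Substitution of the variable `λ` by a complex scalar, or by an operator such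
as `-∂-λ`, is given by `ev`; since `ℂ` is infinite, an identity of
polynomials in (several) variables `λ, μ, γ` with coefficients in a complex
vector space holds formally if and only if it holds for all complex values
of the variables, which is how all identities are stated below.
-/

namespace ConfFormal

variable {L : Type*} [AddCommGroup L] [Module ℂ L]

/-- Evaluation of a polynomial `p = Σₙ λⁿ • pₙ` with coefficients in `L`
(encoded as the family of its coefficients) at an endomorphism `T` of `L`
(for instance at a scalar `λ`, or at an operator such as `-∂-λ`). -/
noncomputable def ev (T : Module.End ℂ L) (p : ℕ →₀ L) : L :=
  p.sum fun n x => (T ^ n) x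

/-- `app m T x y` is `x ∘_T y` : the `λ`-product `x ∘_λ y` recorded by the
`ℂ`-bilinear coefficient map `m`, with the variable `λ` substituted by the
endomorphism `T`. -/
noncomputable def app (m : L →ₗ[ℂ] L →ₗ[ℂ] (ℕ →₀ L)) (T : Module.End ℂ L) (x y : L) : L :=
  ev T (m x y)

/-- The scalar `c` viewed as an endomorphism of `L`. -/
noncomputable def sc (c : ℂ) : Module.End ℂ L := c • (1 : Module.End ℂ L)

/-- `(L, D, m)` is a conformal algebra: conformal sesquilinearity holds. -/
structure IsConfAlg (D : Module.End ℂ L) (m : L →ₗ[ℂ] L →ₗ[ℂ] (ℕ →₀ L)) : Prop where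
  sesq_left : ∀ (x y : L) (l : ℂ), app m (sc l) (D x) y = -l • app m (sc l) x y
  sesq_right : ∀ (x y : L) (l : ℂ),
    app m (sc l) x (D y) = D (app m (sc l) x y) + l • app m (sc l) x y

/-- `(L, D, m)` is a commutative associative conformal algebra. -/
structure IsCommAssocConfAlg (D : Module.End ℂ L) (m : L →ₗ[ℂ] L →ₗ[ℂ] (ℕ →₀ L))
    extends IsConfAlg D m : Prop where
  assoc : ∀ (x y z : L) (l u : ℂ),
    app m (sc l) x (app m (sc u) y z) = app m (sc (l + u)) (app m (sc l) x y) z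
  comm : ∀ (x y : L) (l : ℂ), app m (sc l) x y = app m (-(D + sc l)) y x

/-- `(L, D, br)` is a Lie conformal algebra. -/
structure IsLieConfAlg (D : Module.End ℂ L) (br : L →ₗ[ℂ] L →ₗ[ℂ] (ℕ →₀ L)) : Prop where
  sesq_left : ∀ (x y : L) (l : ℂ), app br (sc l) (D x) y = -l • app br (sc l) x y
  skew : ∀ (x y : L) (l : ℂ), app br (sc l) x y = -app br (-(sc l + D)) y x
  jacobi : ∀ (x y z : L) (l u : ℂ),
    app br (sc l) x (app br (sc u) y z) =
      app br (sc (l + u)) (app br (sc l) x y) z + app br (sc u) y (app br (sc l) x z)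

/-- `(L, D, m, br)` is a transposed Poisson conformal algebra. -/
structure IsTPCA (D : Module.End ℂ L) (m br : L →ₗ[ℂ] L →ₗ[ℂ] (ℕ →₀ L)) : Prop where
  commAssoc : IsCommAssocConfAlg D m
  lie : IsLieConfAlg D br
  tLeibniz : ∀ (x y z : L) (l u : ℂ),
    (2 : ℂ) • app m (sc l) x (app br (sc u) y z) =
      app br (sc (l + u)) (app m (sc l) x y) z + app br (sc u) y (app m (sc l) x z)


/-- `(L, D, st)` is a left-symmetric (pre-Lie) conformal algebra. -/
structure IsLeftSymConfAlg (D : Module.End ℂ L) (st : L →ₗ[ℂ] L →ₗ[ℂ] (ℕ →₀ L))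
    extends IsConfAlg D st : Prop where
  leftSym : ∀ (x y z : L) (l u : ℂ),
    app st (sc (l + u)) (app st (sc l) x y) z - app st (sc l) x (app st (sc u) y z)
      = app st (sc (l + u)) (app st (sc u) y x) z - app st (sc u) y (app st (sc l) x z)

/-- `(L, D, st)` is a Novikov conformal algebra. -/
structure IsNovikovConfAlg (D : Module.End ℂ L) (st : L →ₗ[ℂ] L →ₗ[ℂ] (ℕ →₀ L))
    extends IsLeftSymConfAlg D st : Prop where
  novikov : ∀ (x y z : L) (l u : ℂ),
    app st (sc (l + u)) (app st (sc l) x y) z = app st (-(sc u + D)) (app st (sc l) x z) y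

/-- `(L, D, m, st)` is a Novikov-Poisson conformal algebra. -/
structure IsNovikovPoissonConfAlg (D : Module.End ℂ L)
    (m st : L →ₗ[ℂ] L →ₗ[ℂ] (ℕ →₀ L)) : Prop where
  commAssoc : IsCommAssocConfAlg D m
  novikov : IsNovikovConfAlg D st
  compat₁ : ∀ (x y z : L) (l u : ℂ),
    app st (sc (l + u)) (app m (sc l) x y) z = app m (sc l) x (app st (sc u) y z)
  compat₂ : ∀ (x y z : L) (l u : ℂ),
    app m (sc (l + u)) (app st (sc l) x y) z - app st (sc l) x (app m (sc u) y z)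
      = app m (sc (l + u)) (app st (sc u) y x) z - app st (sc u) y (app m (sc l) x z)

lemma ev_zero (T : Module.End ℂ L) : ev T (0 : ℕ →₀ L) = 0 := by
  simp [ev]

lemma ev_add (T : Module.End ℂ L) (p q : ℕ →₀ L) : ev T (p + q) = ev T p + ev T q :=
  Finsupp.sum_add_index' (fun _ => map_zero _) (fun _ _ _ => map_add _ _ _)

lemma ev_single (T : Module.End ℂ L) (n : ℕ) (x : L) :
    ev T (Finsupp.single n x) = (T ^ n) x :=
  Finsupp.sum_single_index (map_zero _)

lemma ev_sub (T : Module.End ℂ L) (p q : ℕ →₀ L) : ev T (p - q) = ev T p - ev T q := by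
  rw [eq_sub_iff_add_eq, ← ev_add, sub_add_cancel]

lemma sc_apply (c : ℂ) (x : L) : (sc c : Module.End ℂ L) x = c • x := by
  simp [sc]

lemma sc_add (a b : ℂ) : (sc (a + b) : Module.End ℂ L) = sc a + sc b :=
  add_smul _ _ _

lemma commute_sc (T : Module.End ℂ L) (c : ℂ) : Commute T (sc c) :=
  (Commute.one_right T).smul_right c

lemma commute_neg_add_sc (D : Module.End ℂ L) (c : ℂ) : Commute D (-(D + sc c)) :=
  ((Commute.refl D).add_right (commute_sc D c)).neg_right

/-- A linear map intertwining `A` and `B` carries evaluation at `A` to evaluation at `B`. -/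
lemma map_ev {A B : Module.End ℂ L} (φ : Module.End ℂ L)
    (h : ∀ x, φ (A x) = B (φ x)) (p : ℕ →₀ L) :
    φ (ev A p) = ev B (p.mapRange φ (map_zero φ)) := by
  have hpow : ∀ (n : ℕ) (x : L), φ ((A ^ n) x) = (B ^ n) (φ x) := by
    intro n
    induction n with
    | zero => simp
    | succ n ih => intro x; simp only [pow_succ, Module.End.mul_apply, ih, h]
  induction p using Finsupp.induction_linear with
  | zero => simp [ev_zero]
  | add p q hp hq => rw [ev_add, map_add, hp, hq, Finsupp.mapRange_add (map_add φ), ev_add]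
  | single n x => rw [ev_single, hpow, Finsupp.mapRange_single, ev_single]

/-- A polynomial with coefficients in a complex vector space that vanishes at every
scalar is zero. -/
lemma eq_zero_of_ev_sc_eq_zero {p : ℕ →₀ L}
    (h : ∀ c : ℂ, ev (sc c) p = 0) : p = 0 := by
  ext n
  refine (Module.forall_dual_apply_eq_zero_iff ℂ _).1 fun φ => ?_
  let q : Polynomial ℂ := p.sum fun k x => Polynomial.monomial k (φ x)
  have hq : q = 0 := by
    refine Polynomial.funext fun c => ?_
    have hc := congrArg φ (h c)
    simp only [ev, Finsupp.sum, map_sum, map_zero, sc, smul_pow, one_pow, LinearMap.smul_apply,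
      Module.End.one_apply, map_smul, smul_eq_mul] at hc
    simp only [q, Finsupp.sum, Polynomial.eval_finsetSum, Polynomial.eval_monomial,
      Polynomial.eval_zero]
    rw [← hc]
    exact Finset.sum_congr rfl fun _ _ => mul_comm _ _
  have hn := congrArg (fun r => Polynomial.coeff r n) hq
  simp only [q, Finsupp.sum, Polynomial.finsetSum_coeff, Polynomial.coeff_monomial,
    Finset.sum_ite_eq', Polynomial.coeff_zero] at hn
  by_cases h0 : p n = 0
  · rw [h0, map_zero]
  · rwa [if_pos (Finsupp.mem_support_iff.2 h0)] at hn

/-- `SubstEq f T w` says that `f` is a polynomial function of a scalar variable whose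
value, once the variable is replaced by the endomorphism `T`, is `w`. -/
def SubstEq (f : ℂ → L) (T : Module.End ℂ L) (w : L) : Prop :=
  ∃ p : ℕ →₀ L, (∀ c, f c = ev (sc c) p) ∧ w = ev T p

namespace SubstEq

variable {f g : ℂ → L} {T : Module.End ℂ L} {v w : L}

lemma unique (hf : SubstEq f T v) (hg : SubstEq f T w) : v = w := by
  obtain ⟨p, hp, rfl⟩ := hf
  obtain ⟨q, hq, rfl⟩ := hg
  have : p - q = 0 := eq_zero_of_ev_sc_eq_zero fun c => by
    rw [ev_sub, ← hp, ← hq, sub_self]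
  rw [sub_eq_zero.1 this]

lemma congr_eq (hf : SubstEq f T v) (hg : SubstEq g T w) (h : ∀ c, f c = g c) : v = w := by
  obtain rfl : f = g := funext h
  exact hf.unique hg

lemma ev (T : Module.End ℂ L) (p : ℕ →₀ L) :
    SubstEq (fun c => ConfFormal.ev (sc c) p) T (ConfFormal.ev T p) :=
  ⟨p, fun _ => rfl, rfl⟩

lemma const (T : Module.End ℂ L) (x : L) : SubstEq (fun _ => x) T x :=
  ⟨Finsupp.single 0 x, fun c => by simp [ev_single], by simp [ev_single]⟩

lemma add (hf : SubstEq f T v) (hg : SubstEq g T w) :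
    SubstEq (fun c => f c + g c) T (v + w) := by
  obtain ⟨p, hp, rfl⟩ := hf
  obtain ⟨q, hq, rfl⟩ := hg
  exact ⟨p + q, fun c => by simp only [ev_add, hp, hq], by rw [ev_add]⟩

lemma sub (hf : SubstEq f T v) (hg : SubstEq g T w) :
    SubstEq (fun c => f c - g c) T (v - w) := by
  obtain ⟨p, hp, rfl⟩ := hf
  obtain ⟨q, hq, rfl⟩ := hg
  exact ⟨p - q, fun c => by simp only [ev_sub, hp, hq], by rw [ev_sub]⟩

lemma map {A : Module.End ℂ L} (hA : Commute A T) (hf : SubstEq f T v) :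
    SubstEq (fun c => A (f c)) T (A v) := by
  obtain ⟨p, hp, rfl⟩ := hf
  refine ⟨p.mapRange A (map_zero A), fun c => ?_, ?_⟩
  · simp only [hp]
    exact map_ev A (fun x => by rw [sc_apply, sc_apply, map_smul]) p
  · exact map_ev A (fun x => LinearMap.congr_fun hA.eq x) p

lemma smul_var (hf : SubstEq f T v) : SubstEq (fun c => c • f c) T (T v) := by
  obtain ⟨p, hp, rfl⟩ := hf
  have key : ∀ S : Module.End ℂ L,
      ConfFormal.ev S (p.mapDomain (· + 1)) = S (ConfFormal.ev S p) := by
    intro S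
    induction p using Finsupp.induction_linear generalizing f with
    | zero => simp [ev_zero]
    | add p q hp' hq' =>
      rw [Finsupp.mapDomain_add, ev_add, ev_add, map_add, hp' (fun _ => rfl),
        hq' (fun _ => rfl)]
    | single n x =>
      rw [Finsupp.mapDomain_single, ev_single, ev_single, pow_succ', Module.End.mul_apply]
  exact ⟨p.mapDomain (· + 1), fun c => by simp only [key, hp, sc_apply], (key T).symm⟩

/-- Applying the `n`-th power of an operator depending affinely on the variable. -/
lemma affine_pow {A : Module.End ℂ L} (hA : Commute A T) (k : ℂ) (n : ℕ)
    (hf : SubstEq f T v) :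
    SubstEq (fun c => ((A + k • (sc c : Module.End ℂ L)) ^ n) (f c)) T (((A + k • T) ^ n) v) := by
  induction n with
  | zero => simpa using hf
  | succ n ih =>
    have h := (ih.map hA).add (ih.smul_var.map (commute_sc T k).symm)
    convert h using 1
    · funext c
      simp [pow_succ', Module.End.mul_apply, sc_apply, smul_comm k c]
    · simp [pow_succ', Module.End.mul_apply, sc_apply]

/-- Evaluating at an operator depending affinely on the variable, after applying to the
coefficients maps which themselves depend polynomially on the variable. -/
lemma sum_affine {A : Module.End ℂ L} (hA : Commute A T) (k : ℂ) {φ : ℂ → L → L} {ψ : L → L}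
    (h : ∀ x, SubstEq (fun c => φ c x) T (ψ x)) (p : ℕ →₀ L) :
    SubstEq (fun c => p.sum fun n x => ((A + k • (sc c : Module.End ℂ L)) ^ n) (φ c x)) T
      (p.sum fun n x => ((A + k • T) ^ n) (ψ x)) := by
  have key : ∀ s : Finset ℕ,
      SubstEq (fun c => ∑ n ∈ s, ((A + k • (sc c : Module.End ℂ L)) ^ n) (φ c (p n))) T
        (∑ n ∈ s, ((A + k • T) ^ n) (ψ (p n))) := by
    intro s
    induction s using Finset.induction_on with
    | empty => simpa using const T (0 : L)
    | insert a s ha ih =>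
      simp only [Finset.sum_insert ha]
      exact (affine_pow hA k a (h (p a))).add ih
  exact key p.support

lemma ev_affine {A : Module.End ℂ L} (hA : Commute A T) (k : ℂ) (p : ℕ →₀ L) :
    SubstEq (fun c => ConfFormal.ev (A + k • sc c) p) T (ConfFormal.ev (A + k • T) p) :=
  sum_affine hA k (const T) p

end SubstEq

section app

variable (m : L →ₗ[ℂ] L →ₗ[ℂ] (ℕ →₀ L)) (T : Module.End ℂ L)

lemma app_add_left (x y z : L) : app m T (x + y) z = app m T x z + app m T y z := by
  simp [app, ev_add]

lemma app_add_right (x y z : L) : app m T x (y + z) = app m T x y + app m T x z := by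
  simp [app, ev_add]

lemma app_sub_left (x y z : L) : app m T (x - y) z = app m T x z - app m T y z := by
  simp [app, ev_sub]

lemma app_sub_right (x y z : L) : app m T x (y - z) = app m T x y - app m T x z := by
  simp [app, ev_sub]

lemma ev_smul (c : ℂ) (p : ℕ →₀ L) : ev T (c • p) = c • ev T p := by
  rw [← sc_apply c (ev T p), map_ev (B := T) (sc c) (fun x => by simp [sc_apply])]
  congr 1

lemma app_smul_left (c : ℂ) (x y : L) : app m T (c • x) y = c • app m T x y := by
  simp [app, ev_smul]

lemma app_smul_right (c : ℂ) (x y : L) : app m T x (c • y) = c • app m T x y := by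
  simp [app, ev_smul]

/-- `app m T x y` as a linear map in `y`. -/
noncomputable def appRight (x : L) : Module.End ℂ L where
  toFun := app m T x
  map_add' := app_add_right m T x
  map_smul' c y := app_smul_right m T c x y

/-- `app m T x y` as a linear map in `x`. -/
noncomputable def appLeft (y : L) : Module.End ℂ L where
  toFun x := app m T x y
  map_add' x z := app_add_left m T x z y
  map_smul' c x := app_smul_left m T c x y

lemma ev_mapRange (φ : Module.End ℂ L) (p : ℕ →₀ L) :
    ev T (p.mapRange φ (map_zero φ)) = p.sum fun n x => (T ^ n) (φ x) :=
  Finsupp.sum_mapRange_index fun _ => map_zero _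

lemma sum_sc_pow_app_left (u : ℂ) (p : ℕ →₀ L) (y : L) :
    (p.sum fun n x => ((sc u : Module.End ℂ L) ^ n) (app m T x y)) =
      app m T (ev (sc u) p) y := by
  refine (ev_mapRange (sc u) (appLeft m T y) p).symm.trans ?_
  exact (map_ev (appLeft m T y) (fun x => by simp [sc_apply]) p).symm

lemma sum_sc_pow_app_right (u : ℂ) (p : ℕ →₀ L) (x : L) :
    (p.sum fun n y => ((sc u : Module.End ℂ L) ^ n) (app m T x y)) =
      app m T x (ev (sc u) p) := by
  refine (ev_mapRange (sc u) (appRight m T x) p).symm.trans ?_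
  exact (map_ev (appRight m T x) (fun x => by simp [sc_apply]) p).symm

variable {T}

lemma SubstEq.app (x y : L) :
    SubstEq (fun c => ConfFormal.app m (sc c) x y) T (ConfFormal.app m T x y) :=
  SubstEq.ev T (m x y)

lemma SubstEq.app_neg_add {D : Module.End ℂ L} (hT : Commute D T) (x y : L) :
    SubstEq (fun c => ConfFormal.app m (-(D + sc c)) x y) T
      (ConfFormal.app m (-(D + T)) x y) := by
  have h := SubstEq.ev_affine hT.neg_left (-1) (m x y)
  simpa [ConfFormal.app, neg_add, add_comm] using h

lemma SubstEq.app_add_sc (l : ℂ) (x y : L) :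
    SubstEq (fun c => ConfFormal.app m (sc (l + c)) x y) T
      (ConfFormal.app m (sc l + T) x y) := by
  have h := SubstEq.ev_affine (commute_sc T l).symm 1 (m x y)
  simpa [ConfFormal.app, sc_add] using h

lemma SubstEq.app_neg_add_sc (D : Module.End ℂ L) (x y : L) (l u : ℂ) :
    SubstEq (fun w => ConfFormal.app m (sc (l + w)) x y) (-(D + sc (l + u)))
      (ConfFormal.app m (-(D + sc u)) x y) := by
  have h1 := SubstEq.app_add_sc (T := -(D + sc (l + u))) m l x y
  have h2 : sc l + -(D + sc (l + u)) = -(D + sc u) := by rw [sc_add]; abel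
  rwa [h2] at h1

end app

namespace IsConfAlg

variable {D : Module.End ℂ L} {m : L →ₗ[ℂ] L →ₗ[ℂ] (ℕ →₀ L)} (h : IsConfAlg D m)
include h

lemma app_left {T : Module.End ℂ L} (x y : L) :
    app m T (D x) y = -T (app m T x y) := by
  have h2 := (SubstEq.const T (0 : L)).sub (SubstEq.app (T := T) m x y).smul_var
  rw [zero_sub] at h2
  refine (SubstEq.app m (D x) y).congr_eq h2 fun c => ?_
  rw [h.sesq_left, zero_sub, neg_smul]

lemma app_right {T : Module.End ℂ L} (hT : Commute D T) (x y : L) :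
    app m T x (D y) = D (app m T x y) + T (app m T x y) :=
  (SubstEq.app m x (D y)).congr_eq
    (((SubstEq.app m x y).map hT).add (SubstEq.app m x y).smul_var) fun c => h.sesq_right x y c

lemma app_ev_left {T B : Module.End ℂ L} {u : ℂ} (hB : B = T - sc u) (p : ℕ →₀ L) (y : L) :
    app m T (ev (-(D + sc u)) p) y = p.sum fun n x => (B ^ n) (app m T x y) := by
  refine Eq.trans ?_ (ev_mapRange B (appLeft m T y) p)
  refine map_ev (appLeft m T y) (fun x => ?_) p
  change app m T ((-(D + sc u) : Module.End ℂ L) x) y = B (app m T x y)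
  have h1 : (-(D + sc u) : Module.End ℂ L) x = (-1 : ℂ) • (D x + u • x) := by
    simp [sc_apply, add_comm]
  rw [h1, app_smul_left, app_add_left, app_smul_left, h.app_left, hB]
  simp [sc_apply]
  abel

lemma app_ev_right {T B : Module.End ℂ L} (hT : Commute D T) {u : ℂ} (hB : B = -(D + T + sc u))
    (x : L) (p : ℕ →₀ L) :
    app m T x (ev (-(D + sc u)) p) = p.sum fun n y => (B ^ n) (app m T x y) := by
  refine Eq.trans ?_ (ev_mapRange B (appRight m T x) p)
  refine map_ev (appRight m T x) (fun y => ?_) p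
  change app m T x ((-(D + sc u) : Module.End ℂ L) y) = B (app m T x y)
  have h1 : (-(D + sc u) : Module.End ℂ L) y = (-1 : ℂ) • (D y + u • y) := by
    simp [sc_apply, add_comm]
  rw [h1, app_smul_right, app_add_right, app_smul_right, h.app_right hT, hB]
  simp [sc_apply]
  abel

variable (k : L →ₗ[ℂ] L →ₗ[ℂ] (ℕ →₀ L))

/-- Inside the left argument of a product at `λ + μ`, `-∂ - λ` acts as `μ`. -/
lemma app_app_neg_left (a b c : L) (l u : ℂ) :
    app m (sc (l + u)) (app k (-(D + sc l)) a b) c =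
      app m (sc (l + u)) (app k (sc u) a b) c := by
  rw [app.eq_1 k, h.app_ev_left (B := sc u) (by rw [sc_add]; abel), sum_sc_pow_app_left]
  rfl

/-- Inside the right argument of a product at `-∂ - λ - μ`, `-∂ - λ` acts as `μ`. -/
lemma app_app_neg_right (a b c : L) (l u : ℂ) :
    app m (-(D + sc (l + u))) a (app k (-(D + sc l)) b c) =
      app m (-(D + sc (l + u))) a (app k (sc u) b c) := by
  rw [app.eq_1 k, h.app_ev_right (B := sc u) (commute_neg_add_sc D _) (by rw [sc_add]; abel),
    sum_sc_pow_app_right]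
  rfl

lemma substEq_inner_right (a b c : L) (l u : ℂ) :
    SubstEq (fun w => app m (sc l) a (app k (sc w) b c)) (-(D + sc (l + u)))
      (app m (sc l) a (app k (-(D + sc u)) b c)) := by
  rw [app.eq_1 k, h.app_ev_right (commute_sc D l) rfl]
  have h1 := SubstEq.sum_affine (T := -(D + sc (l + u))) (Commute.zero_left _) 1
    (fun x => SubstEq.const _ (app m (sc l) a x)) (k b c)
  simp only [zero_add, one_smul, sum_sc_pow_app_right] at h1
  have h2 : -(D + sc l + sc u) = -(D + sc (l + u)) := by rw [sc_add, add_assoc]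
  rw [h2]
  exact h1

lemma substEq_inner_left (a b c : L) (l u : ℂ) :
    SubstEq (fun w => app m (sc (l + w)) (app k (sc w) a b) c) (-(D + sc (l + u)))
      (app m (-(D + sc u)) (app k (-(D + sc l)) a b) c) := by
  rw [app.eq_1 k,
    h.app_ev_left (B := -(D + sc (l + u))) (by rw [sc_add]; abel)]
  have h1 := SubstEq.sum_affine (T := -(D + sc (l + u))) (Commute.zero_left _) 1
    (fun x => SubstEq.app_neg_add_sc m D x c l u) (k a b)
  simp only [zero_add, one_smul, sum_sc_pow_app_left] at h1
  exact h1

end IsConfAlg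

/-- Left symmetry with the variable of the first argument replaced by `-∂ - λ - μ`. -/
lemma IsLeftSymConfAlg.leftSym_neg {D : Module.End ℂ L} {st : L →ₗ[ℂ] L →ₗ[ℂ] (ℕ →₀ L)}
    (h : IsLeftSymConfAlg D st) (x y z : L) (l u : ℂ) :
    app st (-(D + sc u)) (app st (-(D + sc l)) z x) y
        - app st (-(D + sc (l + u))) z (app st (sc l) x y)
      = app st (-(D + sc u)) (app st (sc l) x z) y
        - app st (sc l) x (app st (-(D + sc u)) z y) := by
  have hc := h.toIsConfAlg
  refine ((hc.substEq_inner_left st z x y l u).sub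
    (SubstEq.app st z (app st (sc l) x y))).congr_eq
    ((SubstEq.app_neg_add_sc st D (app st (sc l) x z) y l u).sub
      (hc.substEq_inner_right st x z y l u)) fun w => ?_
  rw [add_comm l w, h.leftSym]

namespace IsNovikovPoissonConfAlg

variable {D : Module.End ℂ L} {m st : L →ₗ[ℂ] L →ₗ[ℂ] (ℕ →₀ L)}
  (h : IsNovikovPoissonConfAlg D m st)
include h

lemma compat₁_neg_right (x y z : L) (l u : ℂ) :
    app st (-(D + sc u)) (app m (sc l) x z) y
      = app m (sc l) x (app st (-(D + sc u)) z y) :=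
  (SubstEq.app_neg_add_sc st D (app m (sc l) x z) y l u).congr_eq
    (h.commAssoc.toIsConfAlg.substEq_inner_right st x z y l u) fun w => h.compat₁ x z y l w

lemma compat₁_neg_left (x y z : L) (l u : ℂ) :
    app st (-(D + sc u)) (app m (-(D + sc l)) z x) y
      = app m (-(D + sc (l + u))) z (app st (sc l) x y) :=
  (h.novikov.toIsConfAlg.substEq_inner_left m z x y l u).congr_eq
    (SubstEq.app m z (app st (sc l) x y)) fun w => by rw [add_comm l w, h.compat₁]

lemma compat₂_neg (x y z : L) (l u : ℂ) :
    app m (-(D + sc u)) (app st (-(D + sc l)) z x) y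
        - app st (-(D + sc (l + u))) z (app m (sc l) x y)
      = app m (-(D + sc u)) (app st (sc l) x z) y
        - app st (sc l) x (app m (-(D + sc u)) z y) := by
  refine ((h.commAssoc.toIsConfAlg.substEq_inner_left st z x y l u).sub
    (SubstEq.app st z (app m (sc l) x y))).congr_eq
    ((SubstEq.app_neg_add_sc m D (app st (sc l) x z) y l u).sub
      (h.novikov.toIsConfAlg.substEq_inner_right m x z y l u)) fun w => ?_
  rw [add_comm l w, h.compat₂]

/-- `x ∘ [y, z] = y ∗ (x ∘ z) - z ∗ (x ∘ y)`, with the bracket written out. -/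
lemma mul_commutator (x y z : L) (l u : ℂ) :
    app m (sc l) x (app st (sc u) y z) - app m (sc l) x (app st (-(D + sc u)) z y)
      = app st (sc u) y (app m (sc l) x z)
        - app st (-(D + sc (l + u))) z (app m (sc l) x y) := by
  have comm := h.commAssoc.comm
  have e1 : app m (sc (l + u)) (app st (sc u) y x) z
      = app m (-(D + sc u)) (app st (-(D + sc l)) z x) y := by
    rw [comm, ← comm y, ← h.compat₁_neg_right, comm y z u, h.compat₁_neg_left, add_comm l u]
  have e2 : app m (-(D + sc u)) (app st (sc l) x z) y
      = app m (sc l) x (app st (sc u) y z) := by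
    rw [← comm y, ← h.compat₁, ← h.compat₁, comm y x, add_comm u l, add_comm l u,
      h.novikov.toIsConfAlg.app_app_neg_left]
  have e3 : app m (sc (l + u)) (app st (sc l) x y) z
      = app m (sc l) x (app st (-(D + sc u)) z y) := by
    rw [comm, ← h.compat₁_neg_left, ← comm x, h.compat₁_neg_right]
  have h1 := h.compat₂ x y z l u
  have h2 := h.compat₂_neg x y z l u
  rw [← comm y z] at h2
  rw [e3, e1] at h1
  rw [e2] at h2
  linear_combination (norm := module) -h1 - h2

end IsNovikovPoissonConfAlg

/-- The commutator bracket `[a_λ b] = a∗_λ b − b∗_{−∂−λ} a`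
of a Novikov-Poisson conformal algebra makes it a transposed Poisson
conformal algebra. -/
theorem novikovPoisson_tpca {L : Type*} [AddCommGroup L] [Module ℂ L]
    (D : Module.End ℂ L) (m st : L →ₗ[ℂ] L →ₗ[ℂ] (ℕ →₀ L))
    (hNP : IsNovikovPoissonConfAlg D m st)
    (br : L →ₗ[ℂ] L →ₗ[ℂ] (ℕ →₀ L))
    (hbr : ∀ (a b : L) (l : ℂ),
      app br (sc l) a b = app st (sc l) a b - app st (-(D + sc l)) b a) :
    IsTPCA D m br := by
  have hst := hNP.novikov.toIsConfAlg
  refine ⟨hNP.commAssoc, ⟨fun x y l => ?_, fun x y l => ?_, fun x y z l u => ?_⟩,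
    fun x y z l u => ?_⟩
  · rw [hbr, hbr, hst.app_left, hst.app_right (commute_neg_add_sc D l)]
    simp [sc_apply, smul_sub]
  · have hT := commute_neg_add_sc D l
    have h1 := (SubstEq.app br y x).congr_eq
      ((SubstEq.app st y x).sub (SubstEq.app_neg_add st hT x y)) (hbr y x)
    have h2 : -(D + -(D + sc l)) = sc l := by abel
    rw [add_comm (sc l) D, h1, hbr, h2, neg_sub]
  · have h0 := hNP.novikov.leftSym x y z l u
    have h1 := hNP.novikov.toIsLeftSymConfAlg.leftSym_neg x y z l u
    have h2 := hNP.novikov.toIsLeftSymConfAlg.leftSym_neg y x z u l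
    rw [add_comm u l] at h2
    have h3 := hst.app_app_neg_left st y x z l u
    have h4 := hst.app_app_neg_right st z y x l u
    simp only [hbr, app_sub_left, app_sub_right, h3, h4]
    linear_combination (norm := module) -h1 + h2 - h0
  · have h1 := hNP.mul_commutator x y z l u
    rw [hbr, hbr, hbr, app_sub_right, hNP.compat₁, hNP.compat₁_neg_right, two_smul]
    nth_rewrite 1 [h1]
    abel

end ConfFormal
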